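/- arXiv:2510.10447 — 3 statements merged into one kernel-verified Lean document; each statement's English description precedes it below -/
import Mathlib

section
/- Let N ≥ 1 and let J and J' be (N+1)×(N+1) real symmetric tridiagonal matrices with positive off-diagonal entries which are both persymmetric. If J and J' have the same characteristic polynomial (equivalently, the same spectrum counted with multiplicity), then J = J'. -/
namespace Matrix

variable {n : Type*} [Fintype n] [DecidableEq n] {A U : Matrix n n ℝ} {μ : n → ℝ}

/-- Spectral theorem for real symmetric matrices, stated with an orthogonal matrix. -/
theorem IsHermitian.exists_orthogonal_mul_eq_mul_diagonal (hA : A.IsHermitian) :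
    ∃ U : Matrix n n ℝ, U * Uᵀ = 1 ∧ A * U = U * diagonal hA.eigenvalues := by
  have hU : (hA.eigenvectorUnitary : Matrix n n ℝ)ᵀ * hA.eigenvectorUnitary = 1 := by
    simpa [star_eq_conjTranspose] using Unitary.coe_star_mul_self hA.eigenvectorUnitary
  refine ⟨hA.eigenvectorUnitary, mul_eq_one_comm.mp hU, ?_⟩
  ext i j
  have h := congrFun (hA.mulVec_eigenvectorBasis j) i
  rw [mul_diagonal, mul_apply, mul_comm]
  simpa [mulVec, dotProduct] using h

theorem mulVec_col_of_mul_eq_mul_diagonal (hAU : A * U = U * diagonal μ)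
    (s : n) : (A *ᵥ fun i => U i s) = μ s • fun i => U i s := by
  funext i
  have h := congrFun (congrFun hAU i) s
  rw [mul_diagonal, mul_apply, mul_comm] at h
  exact h

theorem pow_apply_of_mul_eq_mul_diagonal (hU : U * Uᵀ = 1)
    (hAU : A * U = U * diagonal μ) (k : ℕ) (i j : n) :
    (A ^ k) i j = ∑ s, U i s * U j s * μ s ^ k := by
  have h : A ^ k * U = U * diagonal μ ^ k := by
    induction k with
    | zero => simp
    | succ k ih => rw [pow_succ, Matrix.mul_assoc, hAU, ← Matrix.mul_assoc, ih, Matrix.mul_assoc,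
        ← pow_succ]
  have h2 : A ^ k = U * diagonal μ ^ k * Uᵀ := by
    rw [← h, Matrix.mul_assoc, hU, Matrix.mul_one]
  rw [h2, diagonal_pow, mul_apply]
  refine Finset.sum_congr rfl fun s _ => ?_
  rw [mul_diagonal, transpose_apply, Pi.pow_apply]
  ring

end Matrix

/-- A real symmetric tridiagonal matrix with positive off-diagonal entries. -/
structure IsJacobi {N : ℕ} (J : Matrix (Fin (N + 1)) (Fin (N + 1)) ℝ) : Prop where
  isSymm : J.IsSymm
  tridiagonal : ∀ i j : Fin (N + 1), 1 < |(i : ℤ) - (j : ℤ)| → J i j = 0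
  pos : ∀ i j : Fin (N + 1), (j : ℕ) = (i : ℕ) + 1 → 0 < J i j

namespace IsJacobi

open Matrix

variable {N : ℕ} {J J' : Matrix (Fin (N + 1)) (Fin (N + 1)) ℝ}

theorem eq_zero_of_lt (hJ : IsJacobi J) {i j : Fin (N + 1)} (h : (i : ℕ) + 1 < j) :
    J i j = 0 := by
  apply hJ.tridiagonal
  rw [lt_abs]
  omega

theorem eq_zero_of_gt (hJ : IsJacobi J) {i j : Fin (N + 1)} (h : (j : ℕ) + 1 < i) :
    J i j = 0 := by
  apply hJ.tridiagonal
  rw [lt_abs]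
  omega

/-- An eigenvector of a Jacobi matrix is determined by its first entry. -/
theorem eq_zero_of_mulVec_eq_smul (hJ : IsJacobi J) {v : Fin (N + 1) → ℝ} {c : ℝ}
    (hv : J *ᵥ v = c • v) (h0 : v 0 = 0) : v = 0 := by
  have key : ∀ k : ℕ, ∀ i : Fin (N + 1), (i : ℕ) ≤ k → v i = 0 := by
    intro k
    induction k with
    | zero =>
      intro i hi
      have : i = 0 := Fin.ext (by simpa using hi)
      rw [this, h0]
    | succ k ih =>
      intro i hi
      rcases Nat.lt_or_ge k i with hki | hki
      · let p : Fin (N + 1) := ⟨k, by omega⟩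
        have hrow := congrFun hv p
        rw [Pi.smul_apply, ih p le_rfl, smul_zero, mulVec, dotProduct,
          Finset.sum_eq_single i] at hrow
        · exact (mul_eq_zero.mp hrow).resolve_left (hJ.pos p i (by simp only [p]; omega)).ne'
        · intro j _ hj
          rcases Nat.lt_or_ge k j with hkj | hkj
          · have : (j : ℕ) ≠ i := fun h => hj (Fin.ext h)
            rw [hJ.eq_zero_of_lt (by simp only [p]; omega), zero_mul]
          · rw [ih j hkj, mul_zero]
        · simp
      · exact ih i hki
  funext i
  exact key i i le_rfl

theorem pow_apply_zero (hJ : IsJacobi J) (k : ℕ) :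
    (∀ j : Fin (N + 1), k < (j : ℕ) → (J ^ k) 0 j = 0) ∧
      ∀ j : Fin (N + 1), (j : ℕ) = k → 0 < (J ^ k) 0 j := by
  induction k with
  | zero =>
    refine ⟨fun j hj => ?_, fun j hj => ?_⟩
    · have : (0 : Fin (N + 1)) ≠ j := by
        rintro rfl
        simp at hj
      simp [this]
    · have : j = 0 := Fin.ext (by simpa using hj)
      simp [this]
  | succ k ih =>
    refine ⟨fun j hj => ?_, fun j hj => ?_⟩
    · rw [pow_succ, mul_apply]
      refine Finset.sum_eq_zero fun i _ => ?_
      rcases Nat.lt_or_ge k i with hki | hki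
      · rw [ih.1 i hki, zero_mul]
      · rw [hJ.eq_zero_of_lt (by omega), mul_zero]
    · let p : Fin (N + 1) := ⟨k, by omega⟩
      rw [pow_succ, mul_apply, Finset.sum_eq_single p]
      · exact mul_pos (ih.2 p rfl) (hJ.pos p j hj)
      · intro i _ hi
        have : (i : ℕ) ≠ k := fun h => hi (Fin.ext h)
        rcases Nat.lt_or_ge k i with hki | hki
        · rw [ih.1 i hki, zero_mul]
        · rw [hJ.eq_zero_of_lt (by omega), mul_zero]
      · simp

/-- An orthogonal matrix which intertwines two Jacobi matrices and fixes the first basis vector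
is the identity. -/
theorem eq_one_of_intertwines (hJ : IsJacobi J) (hJ' : IsJacobi J')
    {Q : Matrix (Fin (N + 1)) (Fin (N + 1)) ℝ} (hQ : Qᵀ * Q = 1) (hQJ : Q * J = J' * Q)
    (h0 : ∀ i, Q i 0 = (1 : Matrix (Fin (N + 1)) (Fin (N + 1)) ℝ) i 0) : Q = 1 := by
  have key : ∀ k : ℕ, ∀ j : Fin (N + 1), (j : ℕ) ≤ k →
      ∀ i, Q i j = (1 : Matrix (Fin (N + 1)) (Fin (N + 1)) ℝ) i j := by
    intro k
    induction k with
    | zero =>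
      intro j hj
      have : j = 0 := Fin.ext (by simpa using hj)
      rw [this]
      exact h0
    | succ k ih =>
      intro j hj
      rcases Nat.lt_or_ge k j with hkj | hkj
      · let p : Fin (N + 1) := ⟨k, by omega⟩
        have hrow : ∀ i : Fin (N + 1), (i : ℕ) ≤ k → Q i j = 0 := by
          intro i hi
          have hij : i ≠ j := by
            rintro rfl
            omega
          have h := congrFun (congrFun hQ i) j
          simpa [mul_apply, ih i hi, one_apply, hij] using h
        have hcol : ∀ i : Fin (N + 1), k < (i : ℕ) → Q i j * J j p = J' i p := by
          intro i hi
          have h := congrFun (congrFun hQJ i) p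
          rw [mul_apply, mul_apply, Finset.sum_eq_single j] at h
          · simpa [ih p le_rfl, one_apply] using h
          · intro l _ hl
            rcases Nat.lt_or_ge k l with hkl | hkl
            · have : (l : ℕ) ≠ j := fun h => hl (Fin.ext h)
              rw [hJ.eq_zero_of_gt (by simp only [p]; omega), mul_zero]
            · have : i ≠ l := by
                rintro rfl
                omega
              rw [ih l hkl, one_apply_ne this, zero_mul]
          · simp
        have hJpos : 0 < J j p := by
          rw [← hJ.isSymm.apply]
          exact hJ.pos p j (by simp only [p]; omega)
        have hJpos' : 0 < J' j p := by
          rw [← hJ'.isSymm.apply]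
          exact hJ'.pos p j (by simp only [p]; omega)
        have hne : ∀ i, i ≠ j → Q i j = 0 := by
          intro i hi
          have hi' : (i : ℕ) ≠ j := fun h => hi (Fin.ext h)
          rcases Nat.lt_or_ge k i with hki | hki
          · have h := hcol i hki
            rw [hJ'.eq_zero_of_gt (by simp only [p]; omega)] at h
            exact (mul_eq_zero.mp h).resolve_right hJpos.ne'
          · exact hrow i hki
        have hpos : 0 < Q j j := by
          have h := hcol j hkj
          rw [← h] at hJpos'
          exact pos_of_mul_pos_left hJpos' hJpos.le
        have hsq : Q j j * Q j j = 1 := by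
          have h := congrFun (congrFun hQ j) j
          rw [mul_apply, Finset.sum_eq_single j] at h
          · simpa using h
          · intro i _ hi
            rw [hne i hi, mul_zero]
          · simp
        intro i
        by_cases hi : i = j
        · subst hi
          rw [one_apply_eq]
          nlinarith
        · rw [hne i hi, one_apply_ne hi]
      · exact ih j hkj
  ext i j
  exact key j j le_rfl i

section Diagonalization

variable {U : Matrix (Fin (N + 1)) (Fin (N + 1)) ℝ} {μ : Fin (N + 1) → ℝ}

theorem first_row_ne_zero (hJ : IsJacobi J) (hU : Uᵀ * U = 1) (hJU : J * U = U * diagonal μ)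
    (s : Fin (N + 1)) : U 0 s ≠ 0 := by
  intro h0
  have hv := hJ.eq_zero_of_mulVec_eq_smul (mulVec_col_of_mul_eq_mul_diagonal hJU s) h0
  have h := congrFun (congrFun hU s) s
  rw [mul_apply, Finset.sum_eq_zero fun i _ => by
    rw [show U i s = 0 from congrFun hv i, mul_zero]] at h
  simp at h

theorem eigenvalues_injective (hJ : IsJacobi J) (hU : Uᵀ * U = 1)
    (hJU : J * U = U * diagonal μ) : Function.Injective μ := by
  intro s r hsr
  by_contra hne
  have hs := mulVec_col_of_mul_eq_mul_diagonal hJU s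
  have hr := mulVec_col_of_mul_eq_mul_diagonal hJU r
  have hv : (U 0 r • (fun i => U i s) - U 0 s • fun i => U i r) = (0 : Fin (N + 1) → ℝ) := by
    refine hJ.eq_zero_of_mulVec_eq_smul (c := μ s) ?_ ?_
    · rw [mulVec_sub, mulVec_smul, mulVec_smul, hs, hr, ← hsr, smul_sub, smul_comm,
        smul_comm (U 0 s)]
    · simp [mul_comm]
  have hss := congrFun (congrFun hU s) s
  have hsr' := congrFun (congrFun hU s) r
  rw [mul_apply] at hss hsr'
  rw [one_apply_ne hne] at hsr'
  rw [one_apply_eq] at hss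
  have h : ∑ i, U i s * (U 0 r * U i s - U 0 s * U i r) = 0 :=
    Finset.sum_eq_zero fun i _ => by
      rw [show U 0 r * U i s - U 0 s * U i r = 0 from congrFun hv i, mul_zero]
  have h' : ∑ i, U i s * (U 0 r * U i s - U 0 s * U i r) =
      U 0 r * ∑ i, Uᵀ s i * U i s - U 0 s * ∑ i, Uᵀ s i * U i r := by
    rw [Finset.mul_sum, Finset.mul_sum, ← Finset.sum_sub_distrib]
    exact Finset.sum_congr rfl fun i _ => by
      rw [transpose_apply]
      ring
  rw [h', hss, hsr', mul_zero, sub_zero, mul_one] at h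
  exact hJ.first_row_ne_zero hU hJU r h

/-- The last entry of an eigenvector of a persymmetric Jacobi matrix is, up to sign, the first. -/
theorem last_row_sq (hJ : IsJacobi J) (hper : ∀ i j, J i j = J i.rev j.rev)
    (hJU : J * U = U * diagonal μ) (s : Fin (N + 1)) :
    U (Fin.last N) s ^ 2 = U 0 s ^ 2 := by
  have hs := mulVec_col_of_mul_eq_mul_diagonal hJU s
  have hrev : (J *ᵥ fun i => U i.rev s) = μ s • fun i => U i.rev s := by
    funext i
    have h := congrFun hs i.rev
    rw [mulVec, dotProduct] at h ⊢
    rw [← Equiv.sum_comp Fin.revPerm] at h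
    simpa [hper i] using h
  have hv : (U 0 s • (fun i => U i.rev s) - U (Fin.last N) s • fun i => U i s) =
      (0 : Fin (N + 1) → ℝ) := by
    refine hJ.eq_zero_of_mulVec_eq_smul (c := μ s) ?_ ?_
    · rw [mulVec_sub, mulVec_smul, mulVec_smul, hs, hrev, smul_sub, smul_comm,
        smul_comm (U (Fin.last N) s)]
    · simp [mul_comm]
  have h := congrFun hv (Fin.last N)
  simp at h
  linarith

/-- Persymmetric Jacobi matrices with the same eigenvalues have normalized eigenvectors whose first
entries agree up to sign. -/
theorem first_row_sq_eq {U' : Matrix (Fin (N + 1)) (Fin (N + 1)) ℝ}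
    (hJ : IsJacobi J) (hJ' : IsJacobi J') (hper : ∀ i j, J i j = J i.rev j.rev)
    (hper' : ∀ i j, J' i j = J' i.rev j.rev) (hU : U * Uᵀ = 1) (hU' : U' * U'ᵀ = 1)
    (hJU : J * U = U * diagonal μ) (hJU' : J' * U' = U' * diagonal μ) (s : Fin (N + 1)) :
    U' 0 s ^ 2 = U 0 s ^ 2 := by
  set G := (J ^ N) 0 (Fin.last N) with hG
  set G' := (J' ^ N) 0 (Fin.last N) with hG'
  have hGpos : 0 < G := (hJ.pow_apply_zero N).2 _ rfl
  have hGpos' : 0 < G' := (hJ'.pow_apply_zero N).2 _ rfl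
  have hμ := hJ.eigenvalues_injective (mul_eq_one_comm.mp hU) hJU
  have hzero := eq_zero_of_forall_pow_sum_mul_pow_eq_zero hμ
    (v := fun s => G' * (U 0 s * U (Fin.last N) s) - G * (U' 0 s * U' (Fin.last N) s)) <| by
      intro k
      have hexp : ∑ s, (G' * (U 0 s * U (Fin.last N) s) - G * (U' 0 s * U' (Fin.last N) s)) *
          μ s ^ (k : ℕ) =
            G' * (J ^ (k : ℕ)) 0 (Fin.last N) - G * (J' ^ (k : ℕ)) 0 (Fin.last N) := by
        rw [pow_apply_of_mul_eq_mul_diagonal hU hJU, pow_apply_of_mul_eq_mul_diagonal hU' hJU',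
          Finset.mul_sum, Finset.mul_sum, ← Finset.sum_sub_distrib]
        exact Finset.sum_congr rfl fun s _ => by ring
      rw [hexp]
      rcases Nat.lt_or_ge k N with hk | hk
      · rw [(hJ.pow_apply_zero k).1 _ hk, (hJ'.pow_apply_zero k).1 _ hk]
        ring
      · have hk' : (k : ℕ) = N := by omega
        rw [hk', ← hG, ← hG']
        ring
  have hprop : ∀ s, G' * U 0 s ^ 2 = G * U' 0 s ^ 2 := by
    intro s
    have h : G' * (U 0 s * U (Fin.last N) s) = G * (U' 0 s * U' (Fin.last N) s) :=
      sub_eq_zero.mp (congrFun hzero s)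
    rw [← sq_eq_sq₀ (by positivity) (by positivity)]
    calc (G' * U 0 s ^ 2) ^ 2 = G' ^ 2 * U 0 s ^ 2 * U (Fin.last N) s ^ 2 := by
          rw [hJ.last_row_sq hper hJU]
          ring
      _ = (G' * (U 0 s * U (Fin.last N) s)) ^ 2 := by ring
      _ = G ^ 2 * U' 0 s ^ 2 * U' (Fin.last N) s ^ 2 := by
          rw [h]
          ring
      _ = (G * U' 0 s ^ 2) ^ 2 := by
          rw [hJ'.last_row_sq hper' hJU']
          ring
  have hnorm : ∀ V : Matrix (Fin (N + 1)) (Fin (N + 1)) ℝ, V * Vᵀ = 1 → ∑ s, V 0 s ^ 2 = 1 := by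
    intro V hV
    have h := congrFun (congrFun hV 0) 0
    simpa [mul_apply, sq] using h
  have hGG : G' = G := by
    have h := Finset.sum_congr (rfl : Finset.univ = Finset.univ) fun s _ => hprop s
    rwa [← Finset.mul_sum, ← Finset.mul_sum, hnorm U hU, hnorm U' hU', mul_one, mul_one] at h
  have h := hprop s
  rw [hGG] at h
  exact (mul_left_cancel₀ hGpos.ne' h).symm

/-- Two Jacobi matrices with the same eigenvalues, and normalized eigenvectors whose first entries
agree up to sign, are equal. -/
theorem eq_of_first_row_sq_eq {U' : Matrix (Fin (N + 1)) (Fin (N + 1)) ℝ}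
    (hJ : IsJacobi J) (hJ' : IsJacobi J') (hU : U * Uᵀ = 1) (hU' : U' * U'ᵀ = 1)
    (hJU : J * U = U * diagonal μ) (hJU' : J' * U' = U' * diagonal μ)
    (hsq : ∀ s, U' 0 s ^ 2 = U 0 s ^ 2) : J = J' := by
  have hUt : Uᵀ * U = 1 := mul_eq_one_comm.mp hU
  have hUt' : U'ᵀ * U' = 1 := mul_eq_one_comm.mp hU'
  have hne := hJ.first_row_ne_zero hUt hJU
  set ε : Fin (N + 1) → ℝ := fun s => U' 0 s / U 0 s with hε
  have hεU : ∀ s, ε s * U 0 s = U' 0 s := fun s => div_mul_cancel₀ _ (hne s)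
  have hεε : diagonal ε * diagonal ε = 1 := by
    rw [diagonal_mul_diagonal, ← diagonal_one]
    congr 1
    funext s
    rw [hε, ← sq, div_pow, hsq, div_self (pow_ne_zero 2 (hne s))]
  have hUJ : Uᵀ * J = diagonal μ * Uᵀ := by
    have h := congrArg transpose hJU
    rwa [transpose_mul, transpose_mul, hJ.isSymm.eq, diagonal_transpose] at h
  have hQJ : U' * diagonal ε * Uᵀ * J = J' * (U' * diagonal ε * Uᵀ) := by
    calc U' * diagonal ε * Uᵀ * J = U' * (diagonal ε * diagonal μ) * Uᵀ := by
          simp only [Matrix.mul_assoc, hUJ]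
      _ = U' * (diagonal μ * diagonal ε) * Uᵀ := by
          rw [(commute_diagonal ε μ).eq]
      _ = J' * (U' * diagonal ε * Uᵀ) := by
          rw [← Matrix.mul_assoc U', ← hJU']
          simp only [Matrix.mul_assoc]
  have hQ : U' * diagonal ε * Uᵀ = 1 := by
    refine hJ.eq_one_of_intertwines hJ' ?_ hQJ ?_
    · calc (U' * diagonal ε * Uᵀ)ᵀ * (U' * diagonal ε * Uᵀ)
          = U * (diagonal ε * (U'ᵀ * U') * diagonal ε) * Uᵀ := by
            simp only [transpose_mul, transpose_transpose, diagonal_transpose, Matrix.mul_assoc]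
        _ = 1 := by rw [hUt', Matrix.mul_one, hεε, Matrix.mul_one, hU]
    · intro i
      rw [← hU', mul_apply, mul_apply]
      refine Finset.sum_congr rfl fun s _ => ?_
      rw [mul_diagonal, transpose_apply, transpose_apply, mul_assoc, hεU]
  rwa [hQ, Matrix.one_mul, Matrix.mul_one] at hQJ

end Diagonalization

end IsJacobi

/-- An (N+1)×(N+1) real symmetric tridiagonal matrix with positive
off-diagonal entries which is persymmetric is determined uniquely by its
characteristic polynomial (equivalently, its spectrum with multiplicity). -/
theorem persymmetric_jacobi_unique_from_spectrum (N : ℕ) (hN : 1 ≤ N)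
    (J J' : Matrix (Fin (N + 1)) (Fin (N + 1)) ℝ)
    (hJsym : J.IsSymm) (hJ'sym : J'.IsSymm)
    (hJtri : ∀ i j : Fin (N + 1), 1 < |(i : ℤ) - (j : ℤ)| → J i j = 0)
    (hJ'tri : ∀ i j : Fin (N + 1), 1 < |(i : ℤ) - (j : ℤ)| → J' i j = 0)
    (hJpos : ∀ i j : Fin (N + 1), (j : ℕ) = (i : ℕ) + 1 → 0 < J i j)
    (hJ'pos : ∀ i j : Fin (N + 1), (j : ℕ) = (i : ℕ) + 1 → 0 < J' i j)
    (hJper : ∀ i j : Fin (N + 1), J i j = J i.rev j.rev)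
    (hJ'per : ∀ i j : Fin (N + 1), J' i j = J' i.rev j.rev)
    (hchar : J.charpoly = J'.charpoly) :
    J = J' := by
  have hJ : IsJacobi J := ⟨hJsym, hJtri, hJpos⟩
  have hJ' : IsJacobi J' := ⟨hJ'sym, hJ'tri, hJ'pos⟩
  have hH : J.IsHermitian := by
    rw [Matrix.IsHermitian, Matrix.conjTranspose_eq_transpose_of_trivial, hJsym.eq]
  have hH' : J'.IsHermitian := by
    rw [Matrix.IsHermitian, Matrix.conjTranspose_eq_transpose_of_trivial, hJ'sym.eq]
  obtain ⟨U, hU, hJU⟩ := hH.exists_orthogonal_mul_eq_mul_diagonal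
  obtain ⟨U', hU', hJU'⟩ := hH'.exists_orthogonal_mul_eq_mul_diagonal
  rw [← (hH.eigenvalues_eq_eigenvalues_iff hH').mpr hchar] at hJU'
  exact hJ.eq_of_first_row_sq_eq hJ' hU hU' hJU hJU'
    (hJ.first_row_sq_eq hJ' hJper hJ'per hU hU' hJU hJU')
end

section
/- Let N ≥ 1 and take Verblunsky parameters â_n = −1/(N+1−n) for 0 ≤ n ≤ N−1 and â_N = −1 (the mirror duals of the single-moment parameters a_n = −1/(n+2)). Then for every 0 ≤ n ≤ N the associated monic polynomials satisfy Φ̂_n(z) = z^n + (1/(N−n+2))·Σ_{k=0}^{n−1} z^k. -/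
open Polynomial

/-- The monic OPUC defined by the Szegő recurrence from Verblunsky parameters `a`:
`Φ_0 = 1`, `Φ_{n+1}(z) = z·Φ_n(z) − conj(a_n)·Φ_n*(z)`, where
`Φ_n*(z) = z^n·conj(Φ_n)(1/z)` is the reversed (conjugated) polynomial. -/
noncomputable def szegoRec (a : ℕ → ℂ) : ℕ → Polynomial ℂ
  | 0 => 1
  | n + 1 => X * szegoRec a n -
      C ((starRingEnd ℂ) (a n)) * reflect n ((szegoRec a n).map (starRingEnd ℂ))

theorem reflect_geom_sum {R : Type*} [Semiring R] (n : ℕ) :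
    reflect n (∑ k ∈ Finset.range n, (X : R[X]) ^ k) = ∑ k ∈ Finset.range n, X ^ (k + 1) := by
  have key : ∀ m ≤ n, reflect n (∑ k ∈ Finset.range m, (X : R[X]) ^ k) =
      ∑ k ∈ Finset.range m, X ^ (n - k) := by
    intro m hm
    induction m with
    | zero => simp
    | succ m ih =>
      rw [Finset.sum_range_succ, Finset.sum_range_succ, reflect_add, ih (by lia),
        reflect_monomial, revAt_le (by lia)]
  rw [key n le_rfl, ← Finset.sum_range_reflect]
  refine Finset.sum_congr rfl fun k hk => ?_
  have := Finset.mem_range.mp hk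
  congr 1
  lia

/-- for the mirror dual single-moment Verblunsky parameters
`â_n = −1/(N+1−n)` (`0 ≤ n ≤ N−1`), `â_N = −1`, one has
`Φ̂_n(z) = z^n + (1/(N−n+2))·Σ_{k=0}^{n−1} z^k` for `0 ≤ n ≤ N`. -/
theorem mirror_single_moment_OPUC (N : ℕ) (hN : 1 ≤ N) (ahat : ℕ → ℂ)
    (ha : ∀ n < N, ahat n = -1 / ((N : ℂ) + 1 - (n : ℂ))) (haN : ahat N = -1) :
    ∀ n ≤ N, szegoRec ahat n =
      X ^ n + C (1 / ((N : ℂ) - (n : ℂ) + 2)) * ∑ k ∈ Finset.range n, X ^ k := by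
  intro n hn
  induction n with
  | zero => simp [szegoRec]
  | succ n ih =>
    obtain ⟨m, rfl⟩ := Nat.exists_eq_add_of_lt hn
    have h2 : (m : ℂ) + 2 ≠ 0 := by exact_mod_cast (by lia : m + 2 ≠ 0)
    have h3 : (m : ℂ) + 3 ≠ 0 := by exact_mod_cast (by lia : m + 3 ≠ 0)
    have e1 : ((n + m + 1 : ℕ) : ℂ) + 1 - n = m + 2 := by push_cast; ring
    have e2 : ((n + m + 1 : ℕ) : ℂ) - n + 2 = m + 3 := by push_cast; ring
    have e3 : ((n + m + 1 : ℕ) : ℂ) - (n + 1 : ℕ) + 2 = m + 2 := by push_cast; ring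
    have hc : (C (1 / ((m : ℂ) + 3)) : ℂ[X]) * (1 + C (1 / ((m : ℂ) + 2))) =
        C (1 / ((m : ℂ) + 2)) := by
      rw [← C_1, ← C_add, ← C_mul]
      congr 1
      field_simp
      ring
    have hX : (X : ℂ[X]) * ∑ k ∈ Finset.range n, X ^ k = ∑ k ∈ Finset.range n, X ^ (k + 1) := by
      simp only [Finset.mul_sum, pow_succ']
    have hmap : ((X : ℂ[X]) ^ n + C (1 / ((m : ℂ) + 3)) * ∑ k ∈ Finset.range n, X ^ k).map
        (starRingEnd ℂ) = X ^ n + C (1 / ((m : ℂ) + 3)) * ∑ k ∈ Finset.range n, X ^ k := by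
      simp [Polynomial.map_sum, map_ofNat]
    have hconj : starRingEnd ℂ (-1 / ((m : ℂ) + 2)) = -(1 / ((m : ℂ) + 2)) := by
      simp [neg_div, map_ofNat]
    rw [szegoRec, ih (by lia), ha n (by lia), e1, e2, e3, hmap, hconj, reflect_add,
      reflect_C_mul, reflect_geom_sum, reflect_monomial, revAt_le le_rfl, Nat.sub_self,
      Finset.sum_range_succ', C_neg]
    linear_combination C (1 / ((m : ℂ) + 3)) * hX + (∑ k ∈ Finset.range n, X ^ (k + 1)) * hc
end

section
/- Let N ≥ 1, ν = π/(2(N+2)), and define a_n = −sin(ν)/sin((2n+3)ν) for 0 ≤ n ≤ N. Then: (i) a_N = −1; (ii) −1 < a_n < 0 for every 0 ≤ n ≤ N−1 (in particular |a_n| < 1); and (iii) a_n = a_{N−1−n} for every 0 ≤ n ≤ N−1, so that (a_n) is a persymmetric Verblunsky sequence with ω = −1, i.e. a_n = −ω·conj(a_{N−1−n}). -/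
theorem Real.sin_lt_sin_of_mem_Ioo_pi_sub {x y : ℝ} (hx : 0 < x)
    (hy : y ∈ Set.Ioo x (Real.pi - x)) :
    Real.sin x < Real.sin y := by
  obtain ⟨h₁, h₂⟩ := hy
  have hs : 0 < Real.sin ((y - x) / 2) :=
    Real.sin_pos_of_pos_of_lt_pi (by linarith) (by linarith)
  have hc : 0 < Real.cos ((y + x) / 2) :=
    Real.cos_pos_of_mem_Ioo ⟨by linarith [Real.pi_pos], by linarith⟩
  have h := Real.sin_sub_sin y x
  nlinarith [mul_pos hs hc]

/-- with `ν = π/(2(N+2))` and `a_n = −sin(ν)/sin((2n+3)ν)`: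
(i) `a_N = −1`; (ii) `−1 < a_n < 0` for `0 ≤ n ≤ N−1` (so `|a_n| < 1`);
(iii) `a_n = a_{N−1−n}` for `0 ≤ n ≤ N−1`, i.e. `(a_n)` is a persymmetric
Verblunsky sequence with `ω = −1`: `a_n = −ω·conj(a_{N−1−n})`. -/
theorem persymmetric_single_moment_parameters (N : ℕ) (hN : 1 ≤ N)
    (ν : ℝ) (hν : ν = Real.pi / (2 * ((N : ℝ) + 2)))
    (a : ℕ → ℝ)
    (ha : ∀ n : ℕ, a n = -Real.sin ν / Real.sin ((2 * (n : ℝ) + 3) * ν)) :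
    a N = -1 ∧
      (∀ n < N, -1 < a n ∧ a n < 0 ∧ |a n| < 1) ∧
      (∀ n < N, a n = a (N - 1 - n)) ∧
      (∀ n < N, ((a n : ℂ)) =
        -(-1 : ℂ) * (starRingEnd ℂ) ((a (N - 1 - n) : ℂ))) := by
  have hνpos : 0 < ν := by
    rw [hν]
    positivity
  have hπ : 2 * ((N : ℝ) + 2) * ν = Real.pi := by
    rw [hν]
    field_simp
  have hsin : 0 < Real.sin ν := by
    refine Real.sin_pos_of_pos_of_lt_pi hνpos ?_
    nlinarith [mul_nonneg (Nat.cast_nonneg (α := ℝ) N) hνpos.le]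
  have hlt : ∀ n < N, Real.sin ν < Real.sin ((2 * (n : ℝ) + 3) * ν) := by
    intro n hn
    have hn' : (n : ℝ) + 1 ≤ N := by exact_mod_cast hn
    refine Real.sin_lt_sin_of_mem_Ioo_pi_sub hνpos ⟨?_, ?_⟩
    · nlinarith [mul_nonneg (Nat.cast_nonneg (α := ℝ) n) hνpos.le]
    · nlinarith [mul_le_mul_of_nonneg_right hn' hνpos.le]
  have hsymm : ∀ n < N, a n = a (N - 1 - n) := by
    intro n hn
    have hcast : ((N - 1 - n : ℕ) : ℝ) = N - 1 - n := by
      rw [Nat.cast_sub (by omega), Nat.cast_sub hN, Nat.cast_one]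
    rw [ha, ha, hcast, ← Real.sin_pi_sub ((2 * (n : ℝ) + 3) * ν), ← hπ]
    congr 2
    ring
  refine ⟨?_, fun n hn => ?_, hsymm, fun n hn => ?_⟩
  · have h : (2 * (N : ℝ) + 3) * ν = Real.pi - ν := by linarith
    rw [ha, h, Real.sin_pi_sub, neg_div, div_self hsin.ne']
  · have h := hlt n hn
    have hneg : a n < 0 := by
      rw [ha]
      exact div_neg_of_neg_of_pos (neg_neg_of_pos hsin) (hsin.trans h)
    have hgt : -1 < a n := by
      rw [ha, lt_div_iff₀ (hsin.trans h)]
      linarith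
    exact ⟨hgt, hneg, abs_lt.mpr ⟨hgt, hneg.trans one_pos⟩⟩
  · rw [Complex.conj_ofReal, ← hsymm n hn, neg_neg, one_mul]
end
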